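/- arXiv:2503.10826 — 2 statements merged into one kernel-verified Lean document; each statement's English description precedes it below -/
import Mathlib

section
/- Let a, b, k, m be positive integers with a, b ≥ 2 and gcd(a,b) = 1, and let S = ⟨Geom(a,b;k)⟩. If the gap set H(S) is equidistributed modulo m, then gcd(ab, m) = 1. -/
/-- The numerical semigroup generated by the geometric sequence
`a^k, a^(k-1)*b, …, b^k`. -/
def geomNS (a b k : ℕ) : AddSubmonoid ℕ :=
  AddSubmonoid.closure ((fun i => a ^ (k - i) * b ^ i) '' Set.Iic k)

/-- A set of naturals is equidistributed modulo `m`: every residue class modulo `m`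
contains the same number of elements of the set. -/
def EquidistMod (T : Set ℕ) (m : ℕ) : Prop :=
  ∀ r s : ZMod m,
    Nat.card {n : ℕ // n ∈ T ∧ (n : ZMod m) = r} =
      Nat.card {n : ℕ // n ∈ T ∧ (n : ZMod m) = s}

/-- If every element of `S` is a multiple of `p` or an element of `S` plus `c`, then translation by
`c` maps the gaps congruent to `1 - c` modulo a multiple of `p` injectively, but not surjectively,
to the gaps congruent to `1`. -/
lemma not_equidistMod_compl_of_dvd_or_eq_add {S : AddSubmonoid ℕ} {p c m : ℕ} (hp : p ≠ 1)
    (hpm : p ∣ m) (hc : 2 ≤ c) (hS : ∀ x ∈ S, p ∣ x ∨ ∃ y ∈ S, x = y + c) (h_one : 1 ∉ S)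
    (hfin : {n : ℕ | n ∉ S}.Finite) : ¬ EquidistMod {n : ℕ | n ∉ S} m := by
  intro h
  have hcard := h (1 - c) 1
  have h_finite : Finite {n : ℕ // n ∈ {n : ℕ | n ∉ S} ∧ (n : ZMod m) = 1} :=
    (hfin.subset fun n hn => hn.1 : {n : ℕ | n ∈ {n : ℕ | n ∉ S} ∧ (n : ZMod m) = 1}.Finite)
  have hmaps : ∀ n : ℕ, n ∉ S → (n : ZMod m) = 1 - c →
      n + c ∉ S ∧ ((n + c : ℕ) : ZMod m) = 1 := by
    intro n hn hnm
    have hmod : ((n + c : ℕ) : ZMod m) = 1 := by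
      rw [Nat.cast_add, hnm, sub_add_cancel]
    refine ⟨fun hmem => ?_, hmod⟩
    rcases hS _ hmem with hdvd | ⟨y, hy, hyc⟩
    · have hmod' : n + c ≡ 1 [MOD m] :=
        (ZMod.natCast_eq_natCast_iff _ _ _).1 (by rw [hmod, Nat.cast_one])
      exact hp (Nat.dvd_one.1 (((hmod'.of_dvd hpm).dvd_iff dvd_rfl).1 hdvd))
    · exact hn (Nat.add_right_cancel hyc ▸ hy)
  let f : {n : ℕ // n ∈ {n : ℕ | n ∉ S} ∧ (n : ZMod m) = 1 - c} →
      {n : ℕ // n ∈ {n : ℕ | n ∉ S} ∧ (n : ZMod m) = 1} :=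
    fun n => ⟨n.1 + c, hmaps n.1 n.2.1 n.2.2⟩
  have hf : Function.Injective f := fun x y hxy =>
    Subtype.ext (Nat.add_right_cancel (congrArg Subtype.val hxy))
  obtain ⟨x, hx⟩ := (hf.bijective_of_nat_card_le hcard.ge).surjective ⟨1, h_one, Nat.cast_one⟩
  have : x.1 + c = 1 := congrArg Subtype.val hx
  omega

lemma one_notMem_geomNS {a b k : ℕ} (ha : 2 ≤ a) (hb : 2 ≤ b) (hk : 0 < k) :
    1 ∉ geomNS a b k := by
  have key : ∀ x ∈ geomNS a b k, x = 0 ∨ 2 ≤ x := by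
    intro x hx
    induction hx using AddSubmonoid.closure_induction with
    | mem x hx =>
      obtain ⟨i, hi, rfl⟩ := hx
      right
      rcases Nat.eq_zero_or_pos i with rfl | hi'
      · simpa using ha.trans (Nat.le_self_pow hk.ne' a)
      · exact (hb.trans (Nat.le_self_pow hi'.ne' b)).trans
          (Nat.le_mul_of_pos_left _ (by positivity))
    | zero => exact Or.inl rfl
    | add x y _ _ hx hy => omega
  intro h
  have := key 1 h
  omega

lemma pow_left_mem_geomNS (a b k : ℕ) : a ^ k ∈ geomNS a b k :=
  AddSubmonoid.subset_closure ⟨0, Nat.zero_le k, by simp⟩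

lemma pow_right_mem_geomNS (a b k : ℕ) : b ^ k ∈ geomNS a b k :=
  AddSubmonoid.subset_closure ⟨k, le_refl k, by simp⟩

lemma finite_compl_geomNS {a b k : ℕ} (ha : 2 ≤ a) (hb : 2 ≤ b) (hk : 0 < k)
    (hab : Nat.Coprime a b) : {n : ℕ | n ∉ geomNS a b k}.Finite := by
  have hfrob := frobeniusNumber_pair (hab.pow k k) (Nat.one_lt_pow hk.ne' ha)
    (Nat.one_lt_pow hk.ne' hb)
  refine (Set.finite_Iic (a ^ k * b ^ k - a ^ k - b ^ k)).subset fun n hn =>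
    hfrob.2 fun h => hn (AddSubmonoid.closure_le.2 ?_ h)
  rintro x (rfl | rfl)
  · exact pow_left_mem_geomNS a b k
  · exact pow_right_mem_geomNS a b k

lemma geomNS_comm (a b k : ℕ) : geomNS a b k = geomNS b a k := by
  have key : ∀ a b : ℕ, geomNS a b k ≤ geomNS b a k := by
    refine fun a b => AddSubmonoid.closure_le.2 ?_
    rintro _ ⟨i, hi, rfl⟩
    exact AddSubmonoid.subset_closure
      ⟨k - i, Nat.sub_le k i, by simp only [Nat.sub_sub_self hi, mul_comm]⟩
  exact le_antisymm (key a b) (key b a)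

lemma dvd_or_eq_add_of_mem_geomNS {a b k x : ℕ} (hx : x ∈ geomNS a b k) :
    a ∣ x ∨ ∃ y ∈ geomNS a b k, x = y + b ^ k := by
  induction hx using AddSubmonoid.closure_induction with
  | mem x hx =>
    obtain ⟨i, hi, rfl⟩ := hx
    rcases (Set.mem_Iic.1 hi).eq_or_lt with rfl | hi
    · exact Or.inr ⟨0, zero_mem _, by simp⟩
    · exact Or.inl ((dvd_pow_self a (Nat.sub_pos_of_lt hi).ne').mul_right _)
  | zero => exact Or.inl (dvd_zero a)
  | add x y hx hy ihx ihy =>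
    rcases ihx with hax | ⟨z, hz, rfl⟩
    · rcases ihy with hay | ⟨z, hz, rfl⟩
      · exact Or.inl (hax.add hay)
      · exact Or.inr ⟨x + z, add_mem hx hz, (add_assoc _ _ _).symm⟩
    · exact Or.inr ⟨z + y, add_mem hz hy, add_right_comm _ _ _⟩

lemma coprime_left_of_equidistMod_compl_geomNS {a b k m : ℕ} (ha : 2 ≤ a) (hb : 2 ≤ b)
    (hk : 0 < k) (hab : Nat.Coprime a b) (h : EquidistMod {n : ℕ | n ∉ geomNS a b k} m) :
    Nat.Coprime a m := by
  by_contra hgcd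
  exact not_equidistMod_compl_of_dvd_or_eq_add hgcd (Nat.gcd_dvd_right a m)
    (hb.trans (Nat.le_self_pow hk.ne' b))
    (fun x hx => (dvd_or_eq_add_of_mem_geomNS hx).imp_left (Nat.gcd_dvd_left a m).trans)
    (one_notMem_geomNS ha hb hk) (finite_compl_geomNS ha hb hk hab) h

theorem stmt_2 (a b k m : ℕ) (ha : 2 ≤ a) (hb : 2 ≤ b) (hk : 0 < k) (hm : 0 < m)
    (hab : Nat.Coprime a b)
    (h : EquidistMod {n : ℕ | n ∉ geomNS a b k} m) :
    Nat.Coprime (a * b) m :=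
  Nat.Coprime.mul_left (coprime_left_of_equidistMod_compl_geomNS ha hb hk hab h)
    (coprime_left_of_equidistMod_compl_geomNS hb ha hk hab.symm (geomNS_comm a b k ▸ h))
end

section
/- Let m > 1 be an integer and n а positive integer. Let c₁, …, c_n and d₁, …, d_n be integers with 1 ≤ c_i, d_i < m and gcd(c_i, m) = gcd(d_i, m) = 1 for all i. If X^m − 1 divides ∏_{i=1}^{n} (X^{c_i} − 1)(X^{m−c_i} − 1) − ∏_{i=1}^{n} (X^{d_i} − 1)(X^{m−d_i} − 1) in ℤ[X], then there exists a permutation σ of {1, …, n} such that for every i, either c_i ≡ d_{σ(i)} (mod m) or c_i + d_{σ(i)} ≡ 0 (mod m). -/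
open Polynomial

section AbelSummation

open Filter Topology Finset

/-- Summation by parts. -/
theorem sum_range_mul_eq_sum_sub_mul (w z : ℕ → ℂ) (N : ℕ) :
    ∑ n ∈ range N, w n * z n =
      ∑ n ∈ range N, (w n - w (n + 1)) * ∑ i ∈ range (n + 1), z i
        + w N * ∑ i ∈ range N, z i := by
  induction N with
  | zero => simp
  | succ N ih => rw [sum_range_succ, ih, sum_range_succ, sum_range_succ z N]; ring

theorem abs_rpow_neg_sub_rpow_neg_succ_le {s : ℝ} (hs : 1 ≤ s) (hs2 : s ≤ 2) (n : ℕ) :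
    |((n : ℝ) + 1) ^ (-s) - ((n : ℝ) + 1 + 1) ^ (-s)| ≤ 2 / ((n : ℝ) + 1) ^ 2 := by
  have hn : (0 : ℝ) < n + 1 := by positivity
  have h1 : ((n : ℝ) + 1 + 1) ^ (-s) =
      ((n : ℝ) + 1) ^ (-s) * (1 + -(1 / ((n : ℝ) + 1 + 1))) ^ s := by
    have : (1 + -(1 / ((n : ℝ) + 1 + 1))) = (n + 1) / (n + 1 + 1) := by field_simp; ring
    rw [this, Real.div_rpow hn.le (by positivity), Real.rpow_neg hn.le,
      Real.rpow_neg (by positivity)]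
    have := (Real.rpow_pos_of_pos hn s).ne'
    field_simp
  have h2 : 1 + s * -(1 / ((n : ℝ) + 1 + 1)) ≤ (1 + -(1 / ((n : ℝ) + 1 + 1))) ^ s :=
    one_add_mul_self_le_rpow_one_add
      (by rw [neg_le_neg_iff, div_le_one (by positivity)]; linarith) hs
  have h3 : ((n : ℝ) + 1 + 1) ^ (-s) ≤ ((n : ℝ) + 1) ^ (-s) :=
    Real.rpow_le_rpow_of_nonpos hn (by linarith) (by linarith)
  have h4 : ((n : ℝ) + 1) ^ (-s) ≤ ((n : ℝ) + 1)⁻¹ := by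
    rw [← Real.rpow_neg_one]
    exact Real.rpow_le_rpow_of_exponent_le (by linarith) (by linarith)
  rw [abs_of_nonneg (by linarith), h1]
  calc _ = ((n : ℝ) + 1) ^ (-s) * (1 - (1 + -(1 / ((n : ℝ) + 1 + 1))) ^ s) := by ring
    _ ≤ ((n : ℝ) + 1) ^ (-s) * (s * (1 / ((n : ℝ) + 1 + 1))) := by
        gcongr; linarith
    _ ≤ ((n : ℝ) + 1)⁻¹ * (2 * (1 / ((n : ℝ) + 1))) := by
        gcongr; linarith
    _ = _ := by field_simp

theorem summable_two_div_succ_sq_mul (C : ℝ) :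
    Summable fun n : ℕ ↦ 2 / ((n : ℝ) + 1) ^ 2 * C := by
  have := (summable_nat_add_iff (f := fun n : ℕ ↦ 1 / (n : ℝ) ^ 2) 1).2
    (Real.summable_one_div_nat_pow.2 one_lt_two)
  refine ((this.mul_left 2).mul_right C).congr fun n ↦ ?_
  push_cast; ring

/-- If `z` has bounded partial sums, then `∑ z n / (n + 1) ^ s` converges for `1 ≤ s ≤ 2`. -/
theorem tendsto_sum_range_rpow_mul {z : ℕ → ℂ} {C : ℝ}
    (hz : ∀ N, ‖∑ i ∈ range N, z i‖ ≤ C) {s : ℝ} (hs : 1 ≤ s) (hs2 : s ≤ 2) :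
    Tendsto (fun N ↦ ∑ n ∈ range N, ((((n : ℝ) + 1) ^ (-s) : ℝ) : ℂ) * z n) atTop
      (𝓝 (∑' n : ℕ, ((((n : ℝ) + 1) ^ (-s) - ((n : ℝ) + 1 + 1) ^ (-s) : ℝ) : ℂ)
        * ∑ i ∈ range (n + 1), z i)) := by
  have hsum : Summable fun n : ℕ ↦
      ((((n : ℝ) + 1) ^ (-s) - ((n : ℝ) + 1 + 1) ^ (-s) : ℝ) : ℂ) * ∑ i ∈ range (n + 1), z i := by
    refine Summable.of_norm_bounded (summable_two_div_succ_sq_mul C) fun n ↦ ?_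
    rw [norm_mul, Complex.norm_real, Real.norm_eq_abs]
    gcongr
    · exact abs_rpow_neg_sub_rpow_neg_succ_le hs hs2 n
    · exact hz _
  have hw : Tendsto (fun N : ℕ ↦ ((((N : ℝ) + 1) ^ (-s) : ℝ) : ℂ) * ∑ i ∈ range N, z i)
      atTop (𝓝 0) := by
    have h0 : Tendsto (fun N : ℕ ↦ ((N : ℝ) + 1) ^ (-s) * C) atTop (𝓝 0) := by
      have := (tendsto_rpow_neg_atTop (by linarith : 0 < s)).comp
        (tendsto_atTop_add_const_right _ (1 : ℝ) tendsto_natCast_atTop_atTop)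
      simpa using this.mul_const C
    refine squeeze_zero_norm (fun N ↦ ?_) h0
    rw [norm_mul, Complex.norm_real, Real.norm_eq_abs, abs_of_nonneg (by positivity)]
    gcongr
    exact hz _
  have := hsum.hasSum.tendsto_sum_nat.add hw
  rw [add_zero] at this
  refine this.congr fun N ↦ ?_
  rw [sum_range_mul_eq_sum_sub_mul (fun n ↦ ((((n : ℝ) + 1) ^ (-s) : ℝ) : ℂ))]
  simp

/-- **Abel's theorem** for Dirichlet series whose coefficients have bounded partial sums. -/
theorem tendsto_nhdsGT_one_of_tendsto_sum {z : ℕ → ℂ} {C : ℝ}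
    (hz : ∀ N, ‖∑ i ∈ range N, z i‖ ≤ C) {F : ℝ → ℂ} {l : ℂ}
    (hF : ∀ s, 1 < s →
      Tendsto (fun N ↦ ∑ n ∈ range N, ((((n : ℝ) + 1) ^ (-s) : ℝ) : ℂ) * z n) atTop (𝓝 (F s)))
    (hl : Tendsto (fun N ↦ ∑ n ∈ range N, ((((n : ℝ) + 1) ^ (-1 : ℝ) : ℝ) : ℂ) * z n) atTop
      (𝓝 l)) :
    Tendsto F (𝓝[>] 1) (𝓝 l) := by
  rw [tendsto_nhds_unique hl (tendsto_sum_range_rpow_mul hz le_rfl one_le_two)]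
  have hmem : ∀ᶠ s : ℝ in 𝓝[>] 1, 1 < s ∧ s ≤ 2 := by
    filter_upwards [self_mem_nhdsWithin, Ioc_mem_nhdsGT (one_lt_two (α := ℝ))] with s h1 h2
    exact ⟨h1, h2.2⟩
  refine Tendsto.congr' (f₁ := fun s : ℝ ↦
    ∑' n : ℕ, ((((n : ℝ) + 1) ^ (-s) - ((n : ℝ) + 1 + 1) ^ (-s) : ℝ) : ℂ)
        * ∑ i ∈ range (n + 1), z i) ?_ ?_
  · filter_upwards [hmem] with s hs
    exact tendsto_nhds_unique (tendsto_sum_range_rpow_mul hz hs.1.le hs.2) (hF s hs.1)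
  · refine tendsto_tsum_of_dominated_convergence (summable_two_div_succ_sq_mul C) (fun n ↦ ?_) ?_
    · refine Tendsto.mul_const _ ?_
      refine (Complex.continuous_ofReal.tendsto _).comp ?_
      refine tendsto_nhdsWithin_of_tendsto_nhds (Continuous.tendsto ?_ 1)
      have h1 : ((n : ℝ) + 1) ≠ 0 := by positivity
      have h2 : ((n : ℝ) + 1 + 1) ≠ 0 := by positivity
      exact ((Real.continuous_const_rpow h1).comp continuous_neg).sub
        ((Real.continuous_const_rpow h2).comp continuous_neg)
    · filter_upwards [hmem] with s hs n
      rw [norm_mul, Complex.norm_real, Real.norm_eq_abs]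
      gcongr
      · exact abs_rpow_neg_sub_rpow_neg_succ_le hs.1.le hs.2 n
      · exact hz _

theorem norm_sum_pow_succ_le {ω : ℂ} (hω : ‖ω‖ = 1) (h1 : ω ≠ 1) (N : ℕ) :
    ‖∑ i ∈ range N, ω ^ (i + 1)‖ ≤ 2 / ‖ω - 1‖ := by
  have : ∑ i ∈ range N, ω ^ (i + 1) = ω * ((ω ^ N - 1) / (ω - 1)) := by
    rw [← geom_sum_eq h1, mul_sum]
    exact sum_congr rfl fun i _ ↦ pow_succ' _ _
  rw [this, norm_mul, hω, one_mul, norm_div]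
  gcongr
  calc _ ≤ ‖ω ^ N‖ + ‖(1 : ℂ)‖ := norm_sub_le _ _
    _ = 2 := by rw [norm_pow, hω]; norm_num

theorem re_one_sub_pos {ω : ℂ} (hω : ‖ω‖ = 1) (h1 : ω ≠ 1) : 0 < (1 - ω).re := by
  have h2 := Complex.sq_norm ω
  rw [hω, Complex.normSq_apply] at h2
  have : ω.re ≤ 1 := by nlinarith [sq_nonneg ω.im]
  rcases this.lt_or_eq with h | h
  · simpa using h
  · refine absurd (Complex.ext (by simpa using h) ?_) h1
    rw [h] at h2
    simpa using h2

/-- The logarithm series converges to `-log (1 - ω)` at the points `ω ≠ 1` of the unit circle. -/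
theorem tendsto_sum_pow_div_neg_log {ω : ℂ} (hω : ‖ω‖ = 1) (h1 : ω ≠ 1) :
    Tendsto (fun N ↦ ∑ n ∈ range N, ((((n : ℝ) + 1) ^ (-1 : ℝ) : ℝ) : ℂ) * ω ^ (n + 1)) atTop
      (𝓝 (-Complex.log (1 - ω))) := by
  have hconv := tendsto_sum_range_rpow_mul (norm_sum_pow_succ_le hω h1) le_rfl one_le_two
  set L := ∑' n : ℕ, ((((n : ℝ) + 1) ^ (-1 : ℝ) - ((n : ℝ) + 1 + 1) ^ (-1 : ℝ) : ℝ) : ℂ)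
        * ∑ i ∈ range (n + 1), ω ^ (i + 1)
  have hf : Tendsto (fun N ↦ ∑ n ∈ range N, ω ^ n / n) atTop (𝓝 L) := by
    rw [← tendsto_add_atTop_iff_nat 1]
    refine hconv.congr fun N ↦ ?_
    rw [sum_range_succ']
    simp [Real.rpow_neg_one, div_eq_inv_mul]
  have habel := tendsto_map'_iff.1 (Complex.tendsto_tsum_powerSeries_nhdsWithin_lt hf)
  have hre := re_one_sub_pos hω h1
  have hlog : Tendsto (fun x : ℝ ↦ -Complex.log (1 - ω * x)) (𝓝[<] 1)
      (𝓝 (-Complex.log (1 - ω))) := by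
    have : ContinuousAt (fun x : ℝ ↦ -Complex.log (1 - ω * x)) 1 := by
      refine ContinuousAt.neg (ContinuousAt.clog (by fun_prop) (Or.inl ?_))
      simpa using hre
    simpa using tendsto_nhdsWithin_of_tendsto_nhds this.tendsto
  have : L = -Complex.log (1 - ω) := by
    refine tendsto_nhds_unique (habel.congr' ?_) hlog
    filter_upwards [Ioo_mem_nhdsLT (zero_lt_one (α := ℝ))] with x hx
    have hn : ‖ω * x‖ < 1 := by
      rw [norm_mul, hω, one_mul, Complex.norm_real, Real.norm_eq_abs, abs_of_pos hx.1]
      exact hx.2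
    rw [← (Complex.hasSum_taylorSeries_neg_log hn).tsum_eq]
    refine tsum_congr fun n ↦ ?_
    rw [mul_pow]; ring
  rwa [this] at hconv

open HurwitzZeta in
/-- The value at `1` of the exponential zeta function. -/
theorem expZeta_one {a : ℝ} (ha : (a : UnitAddCircle) ≠ 0) :
    expZeta a 1 = -Complex.log (1 - Complex.exp (2 * Real.pi * Complex.I * a)) := by
  set ω := Complex.exp (2 * Real.pi * Complex.I * a) with hωdef
  have hω : ‖ω‖ = 1 := by
    rw [hωdef, show 2 * (Real.pi : ℂ) * Complex.I * a = ((2 * Real.pi * a : ℝ) : ℂ) * Complex.I by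
      push_cast; ring]
    exact Complex.norm_exp_ofReal_mul_I _
  have h1 : ω ≠ 1 := by
    intro h
    obtain ⟨k, hk⟩ := Complex.exp_eq_one_iff.1 h
    refine ha ((AddCircle.coe_eq_zero_iff 1).2 ⟨k, ?_⟩)
    have : (2 * Real.pi * Complex.I : ℂ) ≠ 0 := Complex.two_pi_I_ne_zero
    have h3 : (a : ℂ) = k := mul_left_cancel₀ this (by rw [hk]; ring)
    rw [zsmul_eq_mul, mul_one]
    exact_mod_cast h3.symm
  have hlim := tendsto_nhdsGT_one_of_tendsto_sum (norm_sum_pow_succ_le hω h1)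
    (F := fun s : ℝ ↦ expZeta a s) ?_ (tendsto_sum_pow_div_neg_log hω h1)
  · refine tendsto_nhds_unique ?_ hlim
    have : Continuous fun s : ℝ ↦ expZeta (a : UnitAddCircle) (s : ℂ) :=
      (differentiable_expZeta_of_ne_zero ha).continuous.comp Complex.continuous_ofReal
    simpa using tendsto_nhdsWithin_of_tendsto_nhds (this.tendsto 1)
  · intro s hs
    have h := (hasSum_expZeta_of_one_lt_re a (s := (s : ℂ)) (by simpa using hs)).tendsto_sum_nat
    rw [← tendsto_add_atTop_iff_nat 1] at h
    refine h.congr fun N ↦ ?_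
    have hs0 : (s : ℂ) ≠ 0 := by exact_mod_cast (zero_lt_one.trans hs).ne'
    rw [sum_range_succ']
    simp only [Nat.cast_zero, Complex.zero_cpow hs0, div_zero, add_zero]
    refine sum_congr rfl fun n _ ↦ ?_
    rw [hωdef, ← Complex.exp_nat_mul, Complex.ofReal_cpow (by positivity), div_eq_inv_mul,
      Complex.ofReal_neg, Complex.cpow_neg]
    push_cast
    ring_nf

end AbelSummation

section Fourier

open Finset
open scoped ZMod

/-- The number of `i` with `c i = j` plus the number of `i` with `-c i = j`, modulo `M`. -/
noncomputable def signedCount {n : ℕ} (M : ℕ) (c : Fin n → ℕ) (j : ZMod M) : ℂ :=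
  ∑ i, ((if (c i : ZMod M) = j then 1 else 0) + (if -(c i : ZMod M) = j then 1 else 0))

theorem signedCount_eq_mul_card {m n : ℕ} (c : Fin n → ℕ) (x : ZMod m) :
    signedCount m c x = (if x = -x then 2 else 1) *
      Fintype.card {i // s((c i : ZMod m), -(c i : ZMod m)) = s(x, -x)} := by
  rw [Fintype.card_subtype, card_filter, Nat.cast_sum, mul_sum]
  refine sum_congr rfl fun i _ ↦ ?_
  simp only [Sym2.eq_iff, neg_eq_iff_eq_neg, neg_neg, and_self]
  split_ifs <;> grind

theorem natCast_ne_zero_of_coprime {M : ℕ} (hM : 1 < M) {a : ℕ} (ha : a.Coprime M) :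
    (a : ZMod M) ≠ 0 := by
  have : Fact (1 < M) := ⟨hM⟩
  exact ((ZMod.isUnit_iff_coprime a M).2 ha).ne_zero

theorem signedCount_zero {M n : ℕ} (hM : 1 < M) {c : Fin n → ℕ} (hc : ∀ i, (c i).Coprime M) :
    signedCount M c 0 = 0 :=
  sum_eq_zero fun i _ ↦ by simp [natCast_ne_zero_of_coprime hM (hc i)]

theorem aeval_prod_pow_sub_one {n m : ℕ} {ω : ℂ} (hm : ω ^ m = 1) (hω : ‖ω‖ = 1) {c : Fin n → ℕ}
    (hc : ∀ i, c i ≤ m) :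
    aeval ω (∏ i, (((X : ℤ[X]) ^ c i - 1) * ((X : ℤ[X]) ^ (m - c i) - 1))) =
      ((∏ i, ‖ω ^ c i - 1‖ ^ 2 : ℝ) : ℂ) := by
  rw [map_prod, Complex.ofReal_prod]
  refine prod_congr rfl fun i _ ↦ ?_
  have hpow : ω ^ (m - c i) = starRingEnd ℂ (ω ^ c i) := by
    have h1 : ‖ω ^ c i‖ = 1 := by rw [norm_pow, hω, one_pow]
    have h2 : ω ^ (m - c i) * ω ^ c i = 1 := by rw [← pow_add, Nat.sub_add_cancel (hc i), hm]
    rw [← Complex.inv_eq_conj h1]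
    exact eq_inv_of_mul_eq_one_left h2
  simp only [map_mul, map_sub, map_pow, aeval_X, map_one]
  rw [hpow, ← Complex.normSq_eq_norm_sq, ← Complex.mul_conj, map_sub, map_one]

variable {M : ℕ} [NeZero M]

theorem LFunction_sum_mul {ι : Type*} (s : Finset ι) (a : ι → ℂ) (Φ : ι → ZMod M → ℂ) (z : ℂ) :
    ZMod.LFunction (fun n ↦ ∑ i ∈ s, a i * Φ i n) z = ∑ i ∈ s, a i * ZMod.LFunction (Φ i) z := by
  simp only [ZMod.LFunction, mul_sum, sum_mul]
  rw [sum_comm]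
  exact sum_congr rfl fun i _ ↦ sum_congr rfl fun j _ ↦ by ring

theorem sum_dft_eq_zero {Φ : ZMod M → ℂ} (h0 : Φ 0 = 0) : ∑ n, 𝓕 Φ n = 0 := by
  rw [← ZMod.dft_apply_zero, ZMod.dft_dft]
  simp [h0]

/-- By `L(1, χ) ≠ 0`, a Fourier transform supported on units vanishes as soon as the `L`-functions
of all its unit dilates vanish at `1`. -/
theorem dft_eq_zero_of_LFunction_one_eq_zero {Φ : ZMod M → ℂ} (h0 : Φ 0 = 0)
    (hL : ∀ u : (ZMod M)ˣ,
      ∑ j, Φ ((u : ZMod M) * j) * HurwitzZeta.expZeta (ZMod.toAddCircle (-j)) 1 = 0)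
    (hnu : ∀ n, ¬IsUnit n → 𝓕 Φ n = 0) : 𝓕 Φ = 0 := by
  have hLg (u : (ZMod M)ˣ) : ZMod.LFunction (fun n ↦ 𝓕 Φ ((u : ZMod M) * n)) 1 = 0 := by
    rw [← hL u⁻¹, ← ZMod.LFunction_dft (fun j ↦ Φ (((u⁻¹ : (ZMod M)ˣ) : ZMod M) * j))
      (Or.inl (by simpa))]
    congr 1
    funext n
    rw [ZMod.dft_comp_unitMul, inv_inv]
  have hA (χ : DirichletCharacter ℂ M) :
      ∑ u : (ZMod M)ˣ, χ ((u⁻¹ : (ZMod M)ˣ) : ZMod M) * 𝓕 Φ u = 0 := by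
    rcases eq_or_ne χ 1 with rfl | hχ
    · rw [← sum_dft_eq_zero h0, ← sum_subset (subset_univ (univ.map ⟨_, Units.val_injective⟩))
        fun x _ hx ↦ hnu x fun ⟨u, hu⟩ ↦ hx (by simp [← hu])]
      simp only [MulChar.one_apply_coe, one_mul, sum_map, Function.Embedding.coeFn_mk]
    · have hmul (n : ZMod M) :
          ∑ u : (ZMod M)ˣ, χ ((u⁻¹ : (ZMod M)ˣ) : ZMod M) * 𝓕 Φ ((u : ZMod M) * n) =
            (∑ u : (ZMod M)ˣ, χ ((u⁻¹ : (ZMod M)ˣ) : ZMod M) * 𝓕 Φ u) * χ n := by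
        by_cases hn : IsUnit n
        · obtain ⟨v, rfl⟩ := hn
          rw [sum_mul]
          refine Fintype.sum_equiv (Equiv.mulRight v) _ _ fun u ↦ ?_
          change χ (u⁻¹ : (ZMod M)ˣ) * 𝓕 Φ (u * v) = χ ((u * v)⁻¹ : (ZMod M)ˣ) * 𝓕 Φ (u * v) * χ v
          rw [mul_right_comm, ← map_mul, mul_inv_rev, mul_comm v⁻¹, ← Units.val_mul,
            ← Units.val_mul, inv_mul_cancel_right]
        · rw [MulChar.map_nonunit χ hn, mul_zero]
          refine sum_eq_zero fun u _ ↦ ?_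
          rw [hnu _ (by simpa using hn), mul_zero]
      have h1 := LFunction_sum_mul univ (fun u : (ZMod M)ˣ ↦ χ ((u⁻¹ : (ZMod M)ˣ) : ZMod M))
        (fun u n ↦ 𝓕 Φ ((u : ZMod M) * n)) 1
      simp only [hmul, hLg, mul_zero, sum_const_zero] at h1
      have h2 := LFunction_sum_mul {()} (fun _ ↦
        ∑ u : (ZMod M)ˣ, χ ((u⁻¹ : (ZMod M)ˣ) : ZMod M) * 𝓕 Φ u) (fun _ ↦ χ) 1
      simp only [sum_singleton] at h2
      rw [h1] at h2
      exact (mul_eq_zero.1 h2.symm).resolve_right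
        (DirichletCharacter.LFunction_apply_one_ne_zero hχ)
  funext n
  by_cases hn : IsUnit n
  · obtain ⟨v, rfl⟩ := hn
    have h : ∑ χ : DirichletCharacter ℂ M,
        (∑ u : (ZMod M)ˣ, χ ((u⁻¹ : (ZMod M)ˣ) : ZMod M) * 𝓕 Φ u) * χ v = 0 :=
      sum_eq_zero fun χ _ ↦ by rw [hA, zero_mul]
    simp only [sum_mul] at h
    rw [sum_comm] at h
    have h2 (u : (ZMod M)ˣ) : ∑ χ : DirichletCharacter ℂ M,
        χ ((u⁻¹ : (ZMod M)ˣ) : ZMod M) * 𝓕 Φ u * χ v =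
          if u = v then (M.totient : ℂ) * 𝓕 Φ u else 0 := by
      have := DirichletCharacter.sum_char_inv_mul_char_eq ℂ u.isUnit (v : ZMod M)
      rw [ZMod.inv_coe_unit] at this
      simp only [mul_right_comm _ (𝓕 Φ (u : ZMod M))]
      rw [← sum_mul, this]
      simp [Units.ext_iff]
    simp only [h2, sum_ite_eq', mem_univ, if_true] at h
    have : (M.totient : ℂ) ≠ 0 := by
      exact_mod_cast (Nat.totient_pos.2 (NeZero.pos M)).ne'
    exact (mul_eq_zero.1 h).resolve_left this
  · exact hnu n hn

theorem norm_stdAddChar (x : ZMod M) : ‖(ZMod.stdAddChar x : ℂ)‖ = 1 := by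
  rw [ZMod.stdAddChar_apply]; exact Circle.norm_coe _

theorem expZeta_one_add_expZeta_neg_one {x : ZMod M} (hx : x ≠ 0) :
    HurwitzZeta.expZeta (ZMod.toAddCircle (-x)) 1 + HurwitzZeta.expZeta (ZMod.toAddCircle x) 1 =
      ((-2 * Real.log ‖ZMod.stdAddChar x - 1‖ : ℝ) : ℂ) := by
  have key {y : ZMod M} (hy : y ≠ 0) :
      HurwitzZeta.expZeta (ZMod.toAddCircle y) 1 = -Complex.log (1 - ZMod.stdAddChar y) := by
    obtain ⟨k, rfl⟩ := ZMod.intCast_surjective y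
    have h := ZMod.toAddCircle_eq_zero.not.2 hy
    rw [ZMod.toAddCircle_intCast] at h ⊢
    rw [expZeta_one h, ZMod.stdAddChar_coe]
    push_cast
    ring_nf
  have h1 : (ZMod.stdAddChar x : ℂ) ≠ 1 := fun h ↦
    hx (ZMod.injective_stdAddChar (h.trans (AddChar.map_zero_eq_one _).symm))
  have hnorm := norm_stdAddChar x
  have hconj : 1 - ZMod.stdAddChar (-x) = starRingEnd ℂ (1 - ZMod.stdAddChar x) := by
    rw [map_sub, map_one, AddChar.map_neg_eq_inv, Complex.inv_eq_conj hnorm]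
  have hre := re_one_sub_pos hnorm h1
  have harg : (1 - ZMod.stdAddChar x).arg ≠ Real.pi := by
    intro h
    have := (Complex.arg_eq_pi_iff.1 h).1
    linarith
  rw [key hx, key (neg_ne_zero.2 hx), hconj, Complex.log_conj _ harg, ← neg_add, add_comm,
    Complex.add_conj, Complex.log_re, norm_sub_rev]
  push_cast
  ring

theorem sum_signedCount_mul {n : ℕ} (c : Fin n → ℕ) (u : (ZMod M)ˣ) (h : ZMod M → ℂ) :
    ∑ j, signedCount M c ((u : ZMod M) * j) * h j =
      ∑ i, (h (((u⁻¹ : (ZMod M)ˣ) : ZMod M) * c i) + h (-(((u⁻¹ : (ZMod M)ˣ) : ZMod M) * c i))) := by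
  simp only [signedCount, sum_mul]
  rw [sum_comm]
  refine sum_congr rfl fun i _ ↦ ?_
  have (x j : ZMod M) : x = u * j ↔ j = ((u⁻¹ : (ZMod M)ˣ) : ZMod M) * x := by
    rw [Units.eq_inv_mul_iff_mul_eq, eq_comm]
  simp [this, add_mul, sum_add_distrib]

theorem dft_signedCount {n : ℕ} (c : Fin n → ℕ) (k : ZMod M) :
    𝓕 (signedCount M c) k =
      ∑ i, (ZMod.stdAddChar (-((c i : ZMod M) * k)) +
        ZMod.stdAddChar (-(-(c i : ZMod M) * k)) : ℂ) := by
  have := sum_signedCount_mul c (1 : (ZMod M)ˣ) fun j ↦ (ZMod.stdAddChar (-(j * k)) : ℂ)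
  simp only [Units.val_one, one_mul, inv_one] at this
  rw [ZMod.dft_apply, ← this]
  simp only [smul_eq_mul, mul_comm]

theorem stdAddChar_natCast_mul (q M' : ℕ) [NeZero M'] [NeZero (q * M')] (k : ℤ) :
    (ZMod.stdAddChar ((q * k : ℤ) : ZMod (q * M')) : ℂ) = ZMod.stdAddChar (k : ZMod M') := by
  rw [ZMod.stdAddChar_coe, ZMod.stdAddChar_coe]
  have : (q : ℂ) ≠ 0 := by
    exact_mod_cast left_ne_zero_of_mul (NeZero.ne (q * M'))
  have : (M' : ℂ) ≠ 0 := by exact_mod_cast NeZero.ne M'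
  push_cast
  congr 1
  field_simp

theorem dft_signedCount_mul {n : ℕ} (c : Fin n → ℕ) (q M' : ℕ) [NeZero M'] [NeZero (q * M')]
    (k : ℕ) :
    𝓕 (signedCount (q * M') c) ((q * k : ℕ) : ZMod (q * M')) =
      𝓕 (signedCount M' c) (k : ZMod M') := by
  rw [dft_signedCount, dft_signedCount]
  refine sum_congr rfl fun i _ ↦ ?_
  have h1 := stdAddChar_natCast_mul q M' (-(c i * k))
  have h2 := stdAddChar_natCast_mul q M' (c i * k)
  push_cast at h1 h2 ⊢
  rw [neg_mul, neg_mul, neg_neg, neg_neg, ← h1, ← h2]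
  ring_nf

theorem sum_signedCount_mul_expZeta {n : ℕ} (hM : 1 < M) {c : Fin n → ℕ}
    (hc : ∀ i, (c i).Coprime M) (u : (ZMod M)ˣ) :
    ∑ j, signedCount M c ((u : ZMod M) * j) * HurwitzZeta.expZeta (ZMod.toAddCircle (-j)) 1 =
      ((-2 * ∑ i, Real.log ‖ZMod.stdAddChar ((u⁻¹ : (ZMod M)ˣ) : ZMod M) ^ c i - 1‖ : ℝ) : ℂ) := by
  rw [sum_signedCount_mul c u fun j ↦ HurwitzZeta.expZeta (ZMod.toAddCircle (-j)) 1, mul_sum,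
    Complex.ofReal_sum]
  refine sum_congr rfl fun i _ ↦ ?_
  rw [neg_neg, expZeta_one_add_expZeta_neg_one, ← AddChar.map_nsmul_eq_pow, nsmul_eq_mul,
    mul_comm (c i : ZMod M)]
  rw [ne_eq, Units.mul_right_eq_zero]
  exact natCast_ne_zero_of_coprime hM (hc i)

end Fourier

section DirichletInduction

open Finset
open scoped ZMod

theorem dft_signedCount_eq {m n : ℕ} {c d : Fin n → ℕ}
    (hc : ∀ i, c i ≤ m ∧ (c i).Coprime m) (hd : ∀ i, d i ≤ m ∧ (d i).Coprime m)
    (hdvd : ((X : ℤ[X]) ^ m - 1) ∣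
      (∏ i, (((X : ℤ[X]) ^ (c i) - 1) * ((X : ℤ[X]) ^ (m - c i) - 1))
        - ∏ i, (((X : ℤ[X]) ^ (d i) - 1) * ((X : ℤ[X]) ^ (m - d i) - 1))))
    (M : ℕ) [NeZero M] (hM : M ∣ m) : 𝓕 (signedCount M c) = 𝓕 (signedCount M d) := by
  revert ‹NeZero M›
  induction M using Nat.strong_induction_on with
  | _ M ih =>
  intro _
  rcases eq_or_lt_of_le (Nat.one_le_iff_ne_zero.2 (NeZero.ne M)) with rfl | hM1
  · funext k
    simp [dft_signedCount, Subsingleton.elim k 0]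
  have hcM i : (c i).Coprime M := (hc i).2.coprime_dvd_right hM
  have hdM i : (d i).Coprime M := (hd i).2.coprime_dvd_right hM
  rw [← sub_eq_zero, ← map_sub]
  refine dft_eq_zero_of_LFunction_one_eq_zero ?_ (fun u ↦ ?_) fun k hk ↦ ?_
  · rw [Pi.sub_apply, signedCount_zero hM1 hcM, signedCount_zero hM1 hdM, sub_zero]
  · simp only [Pi.sub_apply, sub_mul, sum_sub_distrib]
    rw [sum_signedCount_mul_expZeta hM1 hcM, sum_signedCount_mul_expZeta hM1 hdM, sub_eq_zero]
    set ω := (ZMod.stdAddChar ((u⁻¹ : (ZMod M)ˣ) : ZMod M) : ℂ) with hω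
    have hωm : ω ^ m = 1 := by
      rw [hω, ← AddChar.map_nsmul_eq_pow, nsmul_eq_mul, (ZMod.natCast_eq_zero_iff m M).2 hM,
        zero_mul, AddChar.map_zero_eq_one]
    have hprod := map_dvd (aeval ω) hdvd
    have hne {a : ℕ} (ha : a.Coprime M) : ‖ω ^ a - 1‖ ^ 2 ≠ 0 := by
      rw [pow_ne_zero_iff two_ne_zero, norm_ne_zero_iff, sub_ne_zero, hω,
        ← AddChar.map_nsmul_eq_pow, nsmul_eq_mul]
      intro h
      have h0 := ZMod.injective_stdAddChar (h.trans (AddChar.map_zero_eq_one _).symm)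
      rw [Units.mul_left_eq_zero] at h0
      exact natCast_ne_zero_of_coprime hM1 ha h0
    rw [map_sub, map_sub, map_pow, aeval_X, map_one, hωm, sub_self, zero_dvd_iff, sub_eq_zero,
      aeval_prod_pow_sub_one hωm (norm_stdAddChar _) fun i ↦ (hc i).1,
      aeval_prod_pow_sub_one hωm (norm_stdAddChar _) fun i ↦ (hd i).1] at hprod
    have hlog := congrArg Real.log (Complex.ofReal_injective hprod)
    rw [Real.log_prod fun i _ ↦ hne (hcM i), Real.log_prod fun i _ ↦ hne (hdM i)] at hlog
    simp only [Real.log_pow, ← mul_sum] at hlog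
    rw [mul_left_cancel₀ (by norm_num) hlog]
  · rw [map_sub, Pi.sub_apply, sub_eq_zero]
    obtain ⟨q, k', M', hq, hk', hM'⟩ :
        ∃ q k' M' : ℕ, q ≠ 1 ∧ k = ((q * k' : ℕ) : ZMod M) ∧ M = q * M' := by
      refine ⟨k.val.gcd M, k.val / k.val.gcd M, M / k.val.gcd M, ?_, ?_, ?_⟩
      · rw [← ZMod.natCast_zmod_val k, ZMod.isUnit_iff_coprime] at hk
        exact hk
      · rw [Nat.mul_div_cancel' (Nat.gcd_dvd_left _ _), ZMod.natCast_zmod_val]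
      · rw [Nat.mul_div_cancel' (Nat.gcd_dvd_right _ _)]
    subst hM'
    have hM'0 : M' ≠ 0 := right_ne_zero_of_mul (NeZero.ne (q * M'))
    have hq0 : q ≠ 0 := left_ne_zero_of_mul (NeZero.ne (q * M'))
    have : NeZero M' := ⟨hM'0⟩
    rw [hk', dft_signedCount_mul, dft_signedCount_mul,
      ih M' (lt_mul_of_one_lt_left (by omega) (by omega)) ((dvd_mul_left _ _).trans hM)]

end DirichletInduction

theorem stmt_11 (m n : ℕ) (hm : 1 < m) (hn : 0 < n)
    (c d : Fin n → ℕ)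
    (hc : ∀ i, 1 ≤ c i ∧ c i < m ∧ Nat.Coprime (c i) m)
    (hd : ∀ i, 1 ≤ d i ∧ d i < m ∧ Nat.Coprime (d i) m)
    (hdvd : ((X : ℤ[X]) ^ m - 1) ∣
      (∏ i, (((X : ℤ[X]) ^ (c i) - 1) * ((X : ℤ[X]) ^ (m - c i) - 1))
        - ∏ i, (((X : ℤ[X]) ^ (d i) - 1) * ((X : ℤ[X]) ^ (m - d i) - 1)))) :
    ∃ σ : Equiv.Perm (Fin n), ∀ i,
      c i ≡ d (σ i) [MOD m] ∨ m ∣ (c i + d (σ i)) := by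
  have : NeZero m := ⟨by omega⟩
  have hcount : signedCount m c = signedCount m d := ZMod.dft.injective <|
    dft_signedCount_eq (fun i ↦ ⟨(hc i).2.1.le, (hc i).2.2⟩)
      (fun i ↦ ⟨(hd i).2.1.le, (hd i).2.2⟩) hdvd m dvd_rfl
  have hcard (k : Sym2 (ZMod m)) :
      Fintype.card {i // s((c i : ZMod m), -(c i : ZMod m)) = k} =
        Fintype.card {i // s((d i : ZMod m), -(d i : ZMod m)) = k} := by
    by_cases hk : ∃ x : ZMod m, s(x, -x) = k
    · obtain ⟨x, rfl⟩ := hk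
      have h := congrFun hcount x
      rw [signedCount_eq_mul_card, signedCount_eq_mul_card] at h
      exact_mod_cast mul_left_cancel₀ (by split_ifs <;> norm_num) h
    · push Not at hk
      simp [hk]
  refine ⟨Equiv.ofFiberEquiv fun k ↦ Fintype.equivOfCardEq (hcard k), fun i ↦ ?_⟩
  have h := Equiv.ofFiberEquiv_map (fun k ↦ Fintype.equivOfCardEq (hcard k)) i
  rcases Sym2.eq_iff.1 h with ⟨h, -⟩ | ⟨h, -⟩
  · exact Or.inl ((ZMod.natCast_eq_natCast_iff _ _ _).1 h.symm)
  · right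
    rw [← ZMod.natCast_eq_zero_iff, Nat.cast_add, h, add_neg_cancel]
end
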